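/- Fix positive integers k, n, N. Let π be a lattice path of north- and east-steps from (0,0) to (kn, n) staying weakly above the line x = k·y, and let w̄ = (w̄_1,…,w̄_n) with w̄_i ∈ ℕ_+^{k} be labels satisfying #{1 ≤ j ≤ k : w̄_{ij} ≥ w̄_{i+1,j}} ≤ col_π(i+1) − col_π(i) for all 1 ≤ i < n, where col_π(i) is the x-coordinate of the i-th north-step of π. Let η = (η_1,…,η_m) be the composition of n whose partial-sum set is {1 ≤ i < n : #{1 ≤ j ≤ k : w̄_{ij} ≥ w̄_{i+1,j}} < col_π(i+1) − col_π(i)}. Then, in the polynomial ring ℤ[x_1,…,x_N], Σ_u ∏_{i=1}^{n} x_{u_i} = ∏_{r=1}^{m} e_{η_r}(x_1,…,x_N), where the sum is over all u ∈ {1,…,N}^n such that, setting w_i = (u_i, w̄_{i1},…,w̄_{ik}), one has #{0 ≤ j ≤ k : w_{ij} ≥ w_{i+1,j}} ≤ col_π(i+1) − col_π(i) for all 1 ≤ i < n (with the convention w_{i0} = u_i), and e_r denotes the elementary symmetric polynomial of degree r. -/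

import Mathlib

noncomputable section

/-- A unit lattice step: north or east. -/
inductive Step : Type
  | N : Step
  | E : Step
deriving DecidableEq, Inhabited

/-- Number of east steps of a path. -/
def countE (R : List Step) : ℕ := R.count Step.E

/-- Number of north steps of a path. -/
def countN (R : List Step) : ℕ := R.count Step.N

/-- The set of lattice points visited by a path starting at the origin. -/
def vertices (R : List Step) : Set (ℕ × ℕ) :=
  {p | ∃ t ≤ R.length, p = (countE (R.take t), countN (R.take t))}

/-- `(P, Q)` is a parallelogram polyomino: two lattice paths from `(0,0)` to the
same endpoint, with `P` (the top path) strictly above `Q` except at the endpoints,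
i.e. meeting only at the endpoints, `P` starting north and `Q` starting east. -/
def IsParaPoly (P Q : List Step) : Prop :=
  countE P = countE Q ∧ countN P = countN Q ∧
  P.head? = some Step.N ∧ Q.head? = some Step.E ∧
  vertices P ∩ vertices Q = {(0, 0), (countE P, countN P)}

/-- For each north step (in order), the number of east steps preceding it. -/
def colList : List Step → List ℕ
  | [] => []
  | Step.E :: r => (colList r).map (· + 1)
  | Step.N :: r => 0 :: colList r

/-- `colAt R i` : the number of east steps before the `(i+1)`-st north step
(equal to the total number of east steps if there is no such north step). -/
def colAt (R : List Step) (i : ℕ) : ℕ := (colList R).getD i (countE R)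

/-- The area of a parallelogram polyomino: the number of whole lattice cells
between `P` and `Q`, minus `(m + n − 1)`. -/
def areaPoly (P Q : List Step) : ℕ :=
  (∑ i ∈ Finset.range (countN P), (colAt Q i - colAt P i)) -
    (countE P + countN P - 1)

/-- For each east step (in order), the number of north steps preceding it,
i.e. the height of the line it lies on. -/
def rowList : List Step → List ℕ
  | [] => []
  | Step.N :: r => (rowList r).map (· + 1)
  | Step.E :: r => 0 :: rowList r

/-- The number of east steps of `R` lying on the line `y = h`. -/
def eastOn (R : List Step) (h : ℕ) : ℕ := (rowList R).count h

/-- The lengths of the maximal runs of consecutive north steps of a path,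
read in order. -/
def nRuns (P : List Step) : List ℕ :=
  ((P.splitOn Step.E).map List.length).filter (· != 0)

/-- `π` is a `k^n`-Dyck path: a lattice path from `(0,0)` to `(kn, n)` staying
weakly above the line `x = k·y`. -/
def IsDyck (k n : ℕ) (π : List Step) : Prop :=
  countN π = n ∧ countE π = k * n ∧ ∀ i < n, colAt π i ≤ k * i

/-- The list of proper partial sums of a composition. -/
def partialSumsProper (β : List ℕ) : List ℕ :=
  (List.range (β.length - 1)).map fun t => (β.take (t + 1)).sum

theorem mem_partialSumsProper {β : List ℕ} {i : ℕ} :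
    i ∈ partialSumsProper β ↔ ∃ t, t + 1 < β.length ∧ (β.take (t + 1)).sum = i := by
  simp only [partialSumsProper, List.mem_map, List.mem_range, Nat.lt_sub_iff_add_lt]

theorem mem_partialSumsProper_cons {d : ℕ} {β : List ℕ} {i : ℕ} :
    i ∈ partialSumsProper (d :: β) ↔
      (β ≠ [] ∧ i = d) ∨ ∃ j ∈ partialSumsProper β, i = d + j := by
  simp only [mem_partialSumsProper, List.take_succ_cons, List.sum_cons, List.length_cons]
  constructor
  · rintro ⟨t, ht, rfl⟩
    cases t with
    | zero => exact Or.inl ⟨by rintro rfl; simp at ht, by simp⟩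
    | succ t => exact Or.inr ⟨_, ⟨t, by omega, rfl⟩, rfl⟩
  · rintro (⟨hβ, rfl⟩ | ⟨_, ⟨t, ht, rfl⟩, rfl⟩)
    · exact ⟨0, by have := List.length_pos_iff.2 hβ; omega, by simp⟩
    · exact ⟨t + 1, by omega, rfl⟩

theorem pos_of_mem_partialSumsProper {β : List ℕ} (hβ : ∀ d ∈ β, 0 < d) {i : ℕ}
    (hi : i ∈ partialSumsProper β) : 0 < i := by
  obtain ⟨t, ht, rfl⟩ := mem_partialSumsProper.1 hi
  cases β with
  | nil => simp at ht
  | cons d β =>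
    have := hβ d (by simp)
    simp only [List.take_succ_cons, List.sum_cons]
    omega

theorem Fin.strictMono_iff_forall_lt {α : Type*} [Preorder α] {d : ℕ} {u : Fin d → α} :
    StrictMono u ↔ ∀ i : ℕ, ∀ h : i + 1 < d, u ⟨i, Nat.lt_of_succ_lt h⟩ < u ⟨i + 1, h⟩ := by
  cases d with
  | zero => exact ⟨fun _ i h => by omega, fun _ i => i.elim0⟩
  | succ m =>
    rw [Fin.strictMono_iff_lt_succ]
    exact ⟨fun H i h => H ⟨i, by omega⟩, fun H i => H i (by omega)⟩

/-- `u` increases strictly from each index `i` to `i + 1`, except possibly where `i + 1` is a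
proper partial sum of `β`. -/
def AscendsOffPartialSums {n N : ℕ} (β : List ℕ) (u : Fin n → Fin N) : Prop :=
  ∀ i : ℕ, ∀ h : i + 1 < n, i + 1 ∉ partialSumsProper β →
    u ⟨i, Nat.lt_of_succ_lt h⟩ < u ⟨i + 1, h⟩

theorem ascendsOffPartialSums_append {d N : ℕ} {β : List ℕ} (hβ : ∀ e ∈ β, 0 < e)
    (v : Fin d → Fin N) (w : Fin β.sum → Fin N) :
    AscendsOffPartialSums (d :: β) (Fin.append v w) ↔
      StrictMono v ∧ AscendsOffPartialSums β w := by
  rw [Fin.strictMono_iff_forall_lt]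
  have hl : ∀ i (h : i < d), Fin.append v w ⟨i, by omega⟩ = v ⟨i, h⟩ := fun i h =>
    Fin.append_left v w ⟨i, h⟩
  have hr : ∀ i (h : i < β.sum), Fin.append v w ⟨d + i, by omega⟩ = w ⟨i, h⟩ := fun i h =>
    Fin.append_right v w ⟨i, h⟩
  refine ⟨fun H => ⟨fun i h => ?_, fun i h hi => ?_⟩, fun ⟨H₁, H₂⟩ i h hi => ?_⟩
  · have := H i (by omega) fun hm => by
      rcases mem_partialSumsProper_cons.1 hm with ⟨_, hd⟩ | ⟨j, _, hj⟩ <;> omega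
    rwa [hl i (by omega), hl (i + 1) h] at this
  · have := H (d + i) (by omega) fun hm => by
      rcases mem_partialSumsProper_cons.1 hm with ⟨_, hd⟩ | ⟨j, hj, hij⟩
      · omega
      · exact hi (by rwa [show i + 1 = j by omega])
    rw [hr i (by omega)] at this
    exact this.trans_eq (hr (i + 1) h)
  · rcases lt_trichotomy (i + 1) d with hd | hd | hd
    · rw [hl i (by omega), hl (i + 1) hd]
      exact H₁ i hd
    · refine absurd (mem_partialSumsProper_cons.2 (Or.inl ⟨?_, hd⟩)) hi
      rintro rfl
      simp only [List.sum_nil] at h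
      omega
    · obtain ⟨j, rfl⟩ := Nat.exists_eq_add_of_le (Nat.lt_succ_iff.1 hd)
      have := H₂ j (by omega) fun hm =>
        hi (mem_partialSumsProper_cons.2 (Or.inr ⟨j + 1, hm, by omega⟩))
      rw [hr j (by omega)]
      exact this.trans_eq (hr (j + 1) (by omega)).symm

open Classical in
theorem sum_strictMono_prod_X_eq_esymm (R : Type*) [CommSemiring R] (N d : ℕ) :
    ∑ u : Fin d → Fin N with StrictMono u, ∏ i, (MvPolynomial.X (u i) : MvPolynomial (Fin N) R) =
      MvPolynomial.esymm (Fin N) R d := by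
  rw [MvPolynomial.esymm]
  refine Finset.sum_bij (fun u _ => Finset.univ.image u) ?_ ?_ ?_ ?_
  · intro u hu
    simp only [Finset.mem_filter, Finset.mem_univ, true_and] at hu
    simp [Finset.mem_powersetCard, Finset.card_image_of_injective _ hu.injective]
  · intro u hu v hv huv
    simp only [Finset.mem_filter, Finset.mem_univ, true_and] at hu hv
    refine hu.range_inj hv |>.1 ?_
    simpa using congrArg (fun s : Finset (Fin N) => (s : Set (Fin N))) huv
  · intro s hs
    have hcard := (Finset.mem_powersetCard.1 hs).2
    exact ⟨s.orderEmbOfFin hcard, by simpa using (s.orderEmbOfFin hcard).strictMono, by simp⟩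
  · intro u hu
    simp only [Finset.mem_filter, Finset.mem_univ, true_and] at hu
    rw [Finset.prod_image hu.injective.injOn]

open Classical in
theorem sum_ascendsOffPartialSums_prod_X (R : Type*) [CommSemiring R] (N : ℕ) (β : List ℕ)
    (hβ : ∀ d ∈ β, 0 < d) :
    ∑ u : Fin β.sum → Fin N with AscendsOffPartialSums β u,
        ∏ i, (MvPolynomial.X (u i) : MvPolynomial (Fin N) R) =
      ∏ r ∈ Finset.range β.length, MvPolynomial.esymm (Fin N) R (β.getD r 0) := by
  induction β with
  | nil =>
    change ∑ u : Fin 0 → Fin N with AscendsOffPartialSums [] u,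
      ∏ i : Fin 0, (MvPolynomial.X (u i) : MvPolynomial (Fin N) R) = _
    simp [AscendsOffPartialSums]
  | cons d β ih =>
    have hβ' : ∀ e ∈ β, 0 < e := fun e he => hβ e (List.mem_cons_of_mem _ he)
    rw [List.length_cons, Finset.prod_range_succ']
    simp only [List.getD_cons_succ, List.getD_cons_zero]
    rw [← ih hβ', mul_comm, ← sum_strictMono_prod_X_eq_esymm, Finset.sum_mul_sum,
      ← Finset.sum_product']
    symm
    refine Finset.sum_equiv (Fin.appendEquiv d β.sum) ?_ ?_
    · rintro ⟨v, w⟩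
      simp only [Finset.mem_product, Finset.mem_filter, Finset.mem_univ, true_and]
      exact (ascendsOffPartialSums_append hβ' v w).symm
    · rintro ⟨v, w⟩ _
      refine Eq.trans ?_ (Fin.prod_univ_add
        fun i => (MvPolynomial.X (Fin.append v w i) : MvPolynomial (Fin N) R)).symm
      simp

/-!
STATEMENT 8: in ℤ[x_1,…,x_N],
Σ_u ∏_i x_{u_i} = ∏_r e_{η_r}, the sum being over all u ∈ {1,…,N}^n compatible
with the path π and the labels w̄, where η is the e-composition determined by
(π, w̄).
-/
open Classical in
theorem statement8 (k n N : ℕ) (hk : 0 < k) (hn : 0 < n) (hN : 0 < N)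
    (π : List Step) (hπ : IsDyck k n π)
    (wb : Fin n → Fin k → ℕ) (hwb : ∀ i j, 0 < wb i j)
    (hcond : ∀ i : ℕ, ∀ h : i + 1 < n,
      colAt π i +
        (Finset.univ.filter fun j : Fin k =>
          wb ⟨i + 1, h⟩ j ≤ wb ⟨i, Nat.lt_of_succ_lt h⟩ j).card ≤ colAt π (i + 1))
    (η : List ℕ) (hη_pos : ∀ d ∈ η, 0 < d) (hη_sum : η.sum = n)
    (hη_set : ∀ i : ℕ, ∀ _h0 : 0 < i, ∀ _h1 : i < n,
      (i ∈ partialSumsProper η ↔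
        colAt π (i - 1) +
          (Finset.univ.filter fun j : Fin k =>
            wb ⟨i, by omega⟩ j ≤ wb ⟨i - 1, by omega⟩ j).card < colAt π i)) :
    (∑ u ∈ Finset.univ.filter (fun u : Fin n → Fin N =>
        ∀ i : ℕ, ∀ h : i + 1 < n,
          colAt π i +
            ((Finset.univ.filter fun j : Fin k =>
              wb ⟨i + 1, h⟩ j ≤ wb ⟨i, Nat.lt_of_succ_lt h⟩ j).card +
              (if u ⟨i + 1, h⟩ ≤ u ⟨i, Nat.lt_of_succ_lt h⟩ then 1 else 0))
            ≤ colAt π (i + 1)),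
      ∏ i : Fin n, MvPolynomial.X (u i)) =
    ∏ r ∈ Finset.range η.length,
      MvPolynomial.esymm (Fin N) ℤ (η.getD r 0) := by
  subst hη_sum
  rw [← sum_ascendsOffPartialSums_prod_X ℤ N η hη_pos]
  refine Finset.sum_congr (Finset.filter_congr fun u _ => ?_) fun _ _ => rfl
  refine forall_congr' fun i => forall_congr' fun h => ?_
  have h₁ := hcond i h
  have h₂ := hη_set (i + 1) (by omega) h
  simp only [Nat.add_sub_cancel] at h₂
  rw [h₂, ← not_le (a := u ⟨i + 1, h⟩)]
  split_ifs with hu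
  · simp only [hu, not_true_eq_false, imp_false, not_not]
    omega
  · simp only [hu, not_false_eq_true, implies_true, iff_true]
    omega

end
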